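/- Step (4) of the virial derivation (Eq. 66): assume the momentum constraint ∂_j(ψ⁶ K̂_i^j) = 8π j_i ψ⁶ with j smooth and compactly supported, assume all displayed integrands are integrable, and assume the fluxes at infinity of the following vector fields vanish: ψ⁶ K̂_i^j β^i (index j), ψ⁶ K̂_i^j x^k ∂_k β^i (index j), ψ⁶ K̂_i^k x^j ∂_j β^i (index k), and α ψ⁶ K̂_i^j K̂_j^i x^k (index k). Then −∫ ψ⁶ j_i x^k ∂_k β^i dV = (1/16π) ∫ [ 8π ψ⁶ j_k β^k + ψ¹² K̂_i^j K̂_j^i x^k ∂_k( α ψ^{−6} ) ] dV. -/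

import Mathlib

noncomputable section
open MeasureTheory Filter Topology Real

abbrev E3 := EuclideanSpace ℝ (Fin 3)

/-- Partial derivative in the `i`-th coordinate direction. -/
noncomputable def pd (i : Fin 3) (f : E3 → ℝ) (x : E3) : ℝ :=
  fderiv ℝ f x (EuclideanSpace.single i 1)

/-- Flat Laplacian on `ℝ³`. -/
noncomputable def lap (f : E3 → ℝ) (x : E3) : ℝ := ∑ i, pd i (fun y => pd i f y) x

/-- Surface integral over the sphere of radius `r` (centered at the origin) of the outward
normal component of the vector field with components `F · i`. -/
noncomputable def flux (F : E3 → Fin 3 → ℝ) (r : ℝ) : ℝ :=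
  r ^ 2 * ∫ ω : Metric.sphere (0 : E3) 1,
      (∑ i, F (r • (ω : E3)) i * (ω : E3) i) ∂((volume : Measure E3).toSphere)

/-- Tracefree extrinsic curvature `K̂_i^j` built from lapse `a` and shift `β`. -/
noncomputable def Khat (a : E3 → ℝ) (β : E3 → Fin 3 → ℝ) (i j : Fin 3) (x : E3) : ℝ :=
  (1 / (2 * a x)) *
    (pd i (fun y => β y j) x + pd j (fun y => β y i) x
      - (2 / 3) * (if i = j then (1 : ℝ) else 0) * ∑ k, pd k (fun y => β y k) x)

/-- Double contraction `K̂_i^j K̂_j^i`. -/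
noncomputable def KK (a : E3 → ℝ) (β : E3 → Fin 3 → ℝ) (x : E3) : ℝ :=
  ∑ i, ∑ j, Khat a β i j x * Khat a β j i x

lemma polar_integral (f : E3 → ℝ) (hf : Integrable f) :
    ∫ x, f x = ∫ r in Set.Ioi (0 : ℝ), r ^ 2 *
      ∫ ω : Metric.sphere (0 : E3) 1, f (r • (ω : E3)) ∂((volume : Measure E3).toSphere) := by
  have hdim : Module.finrank ℝ E3 - 1 = 2 := by simp
  have hmp := (volume : Measure E3).measurePreserving_homeomorphUnitSphereProd
  rw [hdim] at hmp
  set G : Metric.sphere (0 : E3) 1 × Set.Ioi (0 : ℝ) → ℝ :=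
    fun p => f ((p.2 : ℝ) • (p.1 : E3)) with hG
  have hGc : ∀ x : ({(0)}ᶜ : Set E3), G (homeomorphUnitSphereProd E3 x) = f x := by
    intro x
    have h0 : ‖(x : E3)‖ ≠ 0 := norm_ne_zero_iff.2 x.2
    simp [hG, smul_smul, h0]
  have hGint : Integrable G ((volume : Measure E3).toSphere.prod (Measure.volumeIoiPow 2)) := by
    rw [← hmp.integrable_comp_emb (Homeomorph.measurableEmbedding _)]
    have : G ∘ (homeomorphUnitSphereProd E3) = f ∘ Subtype.val := by
      funext x; exact hGc x
    rw [this, ← integrableOn_iff_comap_subtypeVal (measurableSet_singleton _).compl]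
    exact hf.integrableOn
  calc
    ∫ x, f x = ∫ x : ({(0)}ᶜ : Set E3), f x ∂((volume : Measure E3).comap (↑)) := by
      rw [integral_subtype_comap (measurableSet_singleton _).compl f,
        restrict_compl_singleton]
    _ = ∫ x : ({(0)}ᶜ : Set E3), G (homeomorphUnitSphereProd E3 x)
          ∂((volume : Measure E3).comap (↑)) := by simp only [hGc]
    _ = ∫ p, G p ∂((volume : Measure E3).toSphere.prod (Measure.volumeIoiPow 2)) :=
      hmp.integral_comp (Homeomorph.measurableEmbedding _) G
    _ = ∫ r : Set.Ioi (0:ℝ), (∫ ω, G (ω, r) ∂((volume : Measure E3).toSphere))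
          ∂(Measure.volumeIoiPow 2) := integral_prod_symm _ hGint
    _ = _ := by
      simp only [Measure.volumeIoiPow, ENNReal.ofReal]
      rw [integral_withDensity_eq_integral_smul (by fun_prop),
        ← integral_subtype_comap measurableSet_Ioi (fun r : ℝ => r ^ 2 *
      ∫ ω : Metric.sphere (0 : E3) 1, f (r • (ω : E3)) ∂((volume : Measure E3).toSphere))]
      refine integral_congr_ae (Eventually.of_forall ?_)
      rintro ⟨r, hr⟩
      have hr' : (0:ℝ) < r := hr
      simp [hG, NNReal.smul_def, max_eq_left (sq_nonneg r)]

/-- cutoff profile -/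
def cutg (s : ℝ) : ℝ := Real.smoothTransition (2 - s)

lemma cutg_contDiff : ContDiff ℝ (⊤ : ℕ∞) cutg :=
  Real.smoothTransition.contDiff.comp (contDiff_const.sub contDiff_id)

lemma cutg_one {s : ℝ} (h : s ≤ 1) : cutg s = 1 :=
  Real.smoothTransition.one_of_one_le (by linarith)

lemma cutg_zero {s : ℝ} (h : 2 ≤ s) : cutg s = 0 :=
  Real.smoothTransition.zero_of_nonpos (by linarith)

lemma cutg_deriv_lt {s : ℝ} (h : s < 1) : deriv cutg s = 0 := by
  have : cutg =ᶠ[𝓝 s] fun _ => (1:ℝ) := by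
    filter_upwards [Iio_mem_nhds h] with t ht using cutg_one (le_of_lt ht)
  rw [this.deriv_eq]; simp

lemma cutg_deriv_gt {s : ℝ} (h : 2 < s) : deriv cutg s = 0 := by
  have : cutg =ᶠ[𝓝 s] fun _ => (0:ℝ) := by
    filter_upwards [Ioi_mem_nhds h] with t ht using cutg_zero (le_of_lt ht)
  rw [this.deriv_eq]; simp

lemma cutg_deriv_cont : Continuous (deriv cutg) :=
  cutg_contDiff.continuous_deriv (by simp)

lemma cutg_deriv_bdd : ∃ C : ℝ, 0 ≤ C ∧ ∀ s, |deriv cutg s| ≤ C := by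
  obtain ⟨C, hC⟩ := (isCompact_Icc (a := (1:ℝ)) (b := 2)).exists_bound_of_continuousOn
    cutg_deriv_cont.continuousOn
  refine ⟨max C 0, le_max_right _ _, fun s => ?_⟩
  by_cases h1 : s < 1
  · rw [cutg_deriv_lt h1]; simp
  by_cases h2 : 2 < s
  · rw [cutg_deriv_gt h2]; simp
  exact (hC s ⟨not_lt.1 h1, not_lt.1 h2⟩).trans (le_max_left _ _)

/-- cutoff function at scale `R` -/
def cutf (R : ℝ) (x : E3) : ℝ := cutg (‖x‖ ^ 2 / R ^ 2)

lemma cutf_contDiff (R : ℝ) : ContDiff ℝ (⊤ : ℕ∞) (cutf R) :=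
  cutg_contDiff.comp ((contDiff_norm_sq ℝ).div_const _)

lemma pd_cutf (R : ℝ) (i : Fin 3) (x : E3) :
    pd i (cutf R) x = deriv cutg (‖x‖ ^ 2 / R ^ 2) * (2 / R ^ 2) * x i := by
  have h1 : HasFDerivAt (fun y : E3 => ‖y‖ ^ 2 / R ^ 2) ((R ^ 2)⁻¹ • (2 • (innerSL ℝ x))) x := by
    have := (hasStrictFDerivAt_norm_sq x).hasFDerivAt.const_mul (R ^ 2)⁻¹
    simpa [div_eq_inv_mul] using this
  have h2 : HasDerivAt cutg (deriv cutg (‖x‖ ^ 2 / R ^ 2)) (‖x‖ ^ 2 / R ^ 2) :=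
    ((cutg_contDiff.differentiable (by simp)) _).hasDerivAt
  have h3 : HasFDerivAt (cutf R) _ x := h2.comp_hasFDerivAt x h1
  rw [pd, h3.fderiv]
  simp [EuclideanSpace.inner_single_right]
  ring

lemma cutf_supp {R : ℝ} (hR : 0 < R) {x : E3} (hx : 2 * R ≤ ‖x‖) : cutf R x = 0 := by
  apply cutg_zero
  rw [le_div_iff₀ (by positivity)]
  nlinarith

lemma cutf_compact {R : ℝ} (hR : 0 < R) : HasCompactSupport (cutf R) := by
  refine HasCompactSupport.intro (isCompact_closedBall (0 : E3) (2 * R)) fun x hx => ?_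
  apply cutf_supp hR
  simp at hx
  exact hx.le

lemma contDiff_pd {f : E3 → ℝ} (hf : ContDiff ℝ (⊤ : ℕ∞) f) (i : Fin 3) :
    ContDiff ℝ (⊤ : ℕ∞) (pd i f) := by
  unfold pd
  exact (hf.fderiv_right (m := (⊤ : ℕ∞)) (by simp)).clm_apply contDiff_const

lemma parts_cutf {R : ℝ} (hR : 0 < R) {f : E3 → ℝ} (hf : ContDiff ℝ (⊤ : ℕ∞) f) (i : Fin 3) :
    Integrable (fun x => cutf R x * pd i f x) ∧ Integrable (fun x => pd i (cutf R) x * f x) ∧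
    ∫ x, cutf R x * pd i f x = - ∫ x, pd i (cutf R) x * f x := by
  have hc := cutf_compact hR
  have hcc := (cutf_contDiff R)
  have hc' : HasCompactSupport (pd i (cutf R)) := by
    unfold pd
    exact hc.fderiv_apply ℝ _
  have i1 : Integrable (fun x => cutf R x * pd i f x) :=
    (hcc.continuous.mul (contDiff_pd hf i).continuous).integrable_of_hasCompactSupport hc.mul_right
  have i2 : Integrable (fun x => pd i (cutf R) x * f x) :=
    ((contDiff_pd hcc i).continuous.mul hf.continuous).integrable_of_hasCompactSupport hc'.mul_right
  have i3 : Integrable (fun x => cutf R x * f x) :=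
    (hcc.continuous.mul hf.continuous).integrable_of_hasCompactSupport hc.mul_right
  refine ⟨i1, i2, ?_⟩
  unfold pd at i1 i2 ⊢
  exact integral_mul_fderiv_eq_neg_fderiv_mul_of_integrable i2 i1 i3
    (fun x _ => hcc.differentiable (by simp) x) (fun x _ => hf.differentiable (by simp) x)

lemma cut_div (F : E3 → Fin 3 → ℝ) (hF : ∀ i, ContDiff ℝ (⊤ : ℕ∞) fun x => F x i)
    {R : ℝ} (hR : 0 < R) :
    ∫ x, cutf R x * ∑ l, pd l (fun y => F y l) x
      = - ∫ r in Set.Ioi (0:ℝ), (deriv cutg (r ^ 2 / R ^ 2) * (2 / R ^ 2) * r) * flux F r := by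
  have hp := fun i => parts_cutf hR (hF i) i
  simp only [Finset.mul_sum]
  rw [integral_finsetSum _ (fun i _ => (hp i).1)]
  simp only [(hp _).2.2]
  rw [Finset.sum_neg_distrib, ← integral_finsetSum _ (fun i _ => (hp i).2.1),
    polar_integral _ (integrable_finsetSum _ (fun i _ => (hp i).2.1))]
  congr 1
  refine setIntegral_congr_fun measurableSet_Ioi fun r hr => ?_
  have hr' : (0:ℝ) < r := hr
  simp only [flux]
  rw [mul_left_comm (deriv cutg (r ^ 2 / R ^ 2) * (2 / R ^ 2) * r)]
  congr 1
  rw [← integral_const_mul]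
  congr 1
  funext ω
  rw [Finset.mul_sum]
  refine Finset.sum_congr rfl fun i _ => ?_
  have hω : ‖(ω : E3)‖ = 1 := by simp
  rw [pd_cutf, norm_smul, hω, mul_one, Real.norm_eq_abs, sq_abs]
  simp
  ring

lemma div_int_zero (F : E3 → Fin 3 → ℝ) (hF : ∀ i, ContDiff ℝ (⊤ : ℕ∞) fun x => F x i)
    (hint : Integrable fun x => ∑ l, pd l (fun y => F y l) x)
    (hflux : Tendsto (flux F) atTop (𝓝 0)) :
    ∫ x, ∑ l, pd l (fun y => F y l) x = 0 := by
  have t1 : Tendsto (fun R : ℝ => ∫ x, cutf R x * ∑ l, pd l (fun y => F y l) x) atTop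
      (𝓝 (∫ x, ∑ l, pd l (fun y => F y l) x)) := by
    refine tendsto_integral_filter_of_dominated_convergence
      (fun x => ‖∑ l, pd l (fun y => F y l) x‖) ?_ ?_ hint.norm ?_
    · exact Eventually.of_forall fun R =>
        (cutf_contDiff R).continuous.aestronglyMeasurable.mul hint.aestronglyMeasurable
    · refine Eventually.of_forall fun R => Eventually.of_forall fun x => ?_
      rw [norm_mul]
      refine mul_le_of_le_one_left (norm_nonneg _) ?_
      unfold cutf cutg
      rw [Real.norm_eq_abs, abs_of_nonneg (Real.smoothTransition.nonneg _)]
      exact Real.smoothTransition.le_one _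
    · refine Eventually.of_forall fun x => ?_
      refine tendsto_const_nhds.congr' ?_
      filter_upwards [eventually_gt_atTop 0, eventually_ge_atTop ‖x‖] with R h0 hR
      have : cutf R x = 1 := by
        apply cutg_one
        rw [div_le_one (by positivity)]
        exact pow_le_pow_left₀ (norm_nonneg _) hR 2
      rw [this, one_mul]
  have t2 : Tendsto (fun R : ℝ => ∫ x, cutf R x * ∑ l, pd l (fun y => F y l) x) atTop (𝓝 0) := by
    obtain ⟨C, hC0, hC⟩ := cutg_deriv_bdd
    rw [Metric.tendsto_atTop]
    intro ε hε
    obtain ⟨N, hN⟩ := Metric.tendsto_atTop.1 hflux (ε / (4 * C + 1)) (by positivity)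
    refine ⟨max N 1, fun R hR => ?_⟩
    have hRN : N ≤ R := (le_max_left _ _).trans hR
    have hR0 : 0 < R := lt_of_lt_of_le one_pos ((le_max_right _ _).trans hR)
    rw [cut_div F hF hR0, dist_zero_right, norm_neg]
    have hsub : ∀ r ∈ Set.Ioi (0:ℝ) \ Set.Icc R (2 * R),
        (deriv cutg (r ^ 2 / R ^ 2) * (2 / R ^ 2) * r) * flux F r = 0 := by
      rintro r ⟨hr0, hr⟩
      have hr0' : (0:ℝ) < r := hr0
      have : deriv cutg (r ^ 2 / R ^ 2) = 0 := by
        by_cases h : r < R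
        · apply cutg_deriv_lt
          rw [div_lt_one (by positivity)]
          nlinarith
        · have h2 : 2 * R < r := by
            by_contra h2
            exact hr ⟨not_lt.1 h, not_lt.1 h2⟩
          apply cutg_deriv_gt
          rw [lt_div_iff₀ (by positivity)]
          nlinarith
      rw [this]; ring
    rw [setIntegral_eq_of_subset_of_forall_sdiff_eq_zero measurableSet_Ioi
      (fun r hr => lt_of_lt_of_le hR0 hr.1) hsub]
    have hb := norm_setIntegral_le_of_norm_le_const (μ := volume) (s := Set.Icc R (2 * R))
      (f := fun r => (deriv cutg (r ^ 2 / R ^ 2) * (2 / R ^ 2) * r) * flux F r)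
      (C := (C * (2 / R ^ 2) * (2 * R)) * (ε / (4 * C + 1))) (by simp) (by
        intro r hr
        have hr0 : 0 < r := lt_of_lt_of_le hR0 hr.1
        have hfl : ‖flux F r‖ ≤ ε / (4 * C + 1) := by
          have := hN r (hRN.trans hr.1)
          rw [dist_zero_right] at this
          exact this.le
        rw [norm_mul, norm_mul, norm_mul, Real.norm_of_nonneg hr0.le,
          Real.norm_of_nonneg (show 0 ≤ 2 / R ^ 2 by positivity)]
        have := hC (r ^ 2 / R ^ 2)
        rw [← Real.norm_eq_abs] at this
        have h2 := hr.2
        gcongr)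
    refine lt_of_le_of_lt hb ?_
    rw [Real.volume_real_Icc_of_le (by linarith)]
    have : C * (2 / R ^ 2) * (2 * R) * (ε / (4 * C + 1)) * (2 * R - R)
        = ε * ((4 * C) / (4 * C + 1)) := by
      field_simp
      ring
    rw [this]
    have : (4 * C) / (4 * C + 1) < 1 := by
      rw [div_lt_one (by positivity)]; linarith
    nlinarith
  exact tendsto_nhds_unique t1 t2

lemma pd_mul {f g : E3 → ℝ} (hf : ContDiff ℝ (⊤ : ℕ∞) f) (hg : ContDiff ℝ (⊤ : ℕ∞) g)
    (i : Fin 3) (x : E3) :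
    pd i (fun y => f y * g y) x = pd i f x * g x + f x * pd i g x := by
  unfold pd
  rw [fderiv_fun_mul (hf.differentiable (by simp) x) (hg.differentiable (by simp) x)]
  simp
  ring

lemma pd_sum {f : Fin 3 → E3 → ℝ} (hf : ∀ k, ContDiff ℝ (⊤ : ℕ∞) (f k)) (i : Fin 3) (x : E3) :
    pd i (fun y => ∑ k, f k y) x = ∑ k, pd i (f k) x := by
  unfold pd
  rw [fderiv_fun_sum (fun k _ => (hf k).differentiable (by simp) x)]
  simp

lemma contDiff_coord (k : Fin 3) : ContDiff ℝ (⊤ : ℕ∞) (fun y : E3 => y k) := by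
  fun_prop

lemma pd_coord (i k : Fin 3) (x : E3) :
    pd i (fun y : E3 => y k) x = if k = i then 1 else 0 := by
  have h : HasFDerivAt (fun y : E3 => y k) (EuclideanSpace.proj k : E3 →L[ℝ] ℝ) x :=
    (EuclideanSpace.proj k : E3 →L[ℝ] ℝ).hasFDerivAt
  rw [pd, h.fderiv]
  simp

lemma pd_comm {f : E3 → ℝ} (hf : ContDiff ℝ (⊤ : ℕ∞) f) (i k : Fin 3) (x : E3) :
    pd i (pd k f) x = pd k (pd i f) x := by
  have hsym : IsSymmSndFDerivAt ℝ f x :=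
    ((hf.of_le (m := 2) (WithTop.coe_le_coe.2 (le_top : (2 : ℕ∞) ≤ ⊤))).contDiffAt (x := x)).isSymmSndFDerivAt (by
      rw [minSmoothness_of_isRCLikeNormedField])
  have hd : DifferentiableAt ℝ (fderiv ℝ f) x :=
    (hf.fderiv_right (m := (⊤ : ℕ∞)) (by simp)).differentiable (by simp) x
  have key : ∀ a b : Fin 3, pd a (pd b f) x
      = fderiv ℝ (fderiv ℝ f) x (EuclideanSpace.single a 1) (EuclideanSpace.single b 1) := by
    intro a b
    have : pd b f = fun y => (fderiv ℝ f y) (EuclideanSpace.single b 1) := rfl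
    rw [this, pd, fderiv_clm_apply hd (differentiableAt_const _)]
    simp
  rw [key, key]
  exact hsym _ _

lemma div_contract (S : Fin 3 → Fin 3 → E3 → ℝ) (v : Fin 3 → E3 → ℝ)
    (hS : ∀ i l, ContDiff ℝ (⊤ : ℕ∞) (S i l)) (hv : ∀ i, ContDiff ℝ (⊤ : ℕ∞) (v i)) (x : E3) :
    ∑ l, pd l (fun y => ∑ i, S i l y * v i y) x
      = ∑ i, (∑ l, pd l (S i l) x) * v i x + ∑ i, ∑ l, S i l x * pd l (v i) x := by
  have : ∀ l, pd l (fun y => ∑ i, S i l y * v i y) x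
      = ∑ i, (pd l (S i l) x * v i x + S i l x * pd l (v i) x) := by
    intro l
    rw [pd_sum (fun i => (hS i l).mul (hv i))]
    exact Finset.sum_congr rfl fun i _ => pd_mul (hS i l) (hv i) l x
  simp only [this]
  rw [Finset.sum_comm]
  simp only [Finset.sum_add_distrib, Finset.sum_mul]

lemma contDiff_euler {f : E3 → ℝ} (hf : ContDiff ℝ (⊤ : ℕ∞) f) :
    ContDiff ℝ (⊤ : ℕ∞) (fun y : E3 => ∑ k, y k * pd k f y) :=
  ContDiff.sum fun k _ => (contDiff_coord k).mul (contDiff_pd hf k)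

lemma pd_euler {f : E3 → ℝ} (hf : ContDiff ℝ (⊤ : ℕ∞) f) (l : Fin 3) (x : E3) :
    pd l (fun y : E3 => ∑ k, y k * pd k f y) x
      = pd l f x + ∑ k, x k * pd k (pd l f) x := by
  rw [pd_sum (f := fun k y => y k * pd k f y)
    (fun k => (contDiff_coord k).mul (contDiff_pd hf k))]
  simp only [pd_mul (contDiff_coord _) (contDiff_pd hf _), pd_coord, Finset.sum_add_distrib,
    pd_comm hf l]
  simp

lemma contDiff_Khat {a : E3 → ℝ} {β : E3 → Fin 3 → ℝ} (ha : ∀ x, 0 < a x)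
    (haC : ContDiff ℝ (⊤ : ℕ∞) a) (hβC : ∀ i, ContDiff ℝ (⊤ : ℕ∞) fun x => β x i)
    (i l : Fin 3) : ContDiff ℝ (⊤ : ℕ∞) (Khat a β i l) := by
  unfold Khat
  refine (contDiff_const.div (contDiff_const.mul haC)
    (fun x => (mul_pos two_pos (ha x)).ne')).mul ?_
  exact ((contDiff_pd (hβC l) i).add (contDiff_pd (hβC i) l)).sub
    (contDiff_const.mul (ContDiff.sum fun k _ => contDiff_pd (hβC k) k))

lemma Khat_symm (a : E3 → ℝ) (β : E3 → Fin 3 → ℝ) (i l : Fin 3) (x : E3) :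
    Khat a β i l x = Khat a β l i x := by
  unfold Khat
  simp only [eq_comm (a := i) (b := l)]
  ring

lemma Khat_trace (a : E3 → ℝ) (β : E3 → Fin 3 → ℝ) (x : E3) :
    ∑ i, Khat a β i i x = 0 := by
  simp only [Khat, Fin.sum_univ_three, if_true]
  ring

lemma alpha_Khat {a : E3 → ℝ} {β : E3 → Fin 3 → ℝ} (ha : ∀ x, 0 < a x) (i l : Fin 3) (x : E3) :
    a x * Khat a β i l x = (1 / 2) * (pd i (fun y => β y l) x + pd l (fun y => β y i) x)
      + (-(1 / 3) * (if i = l then (1 : ℝ) else 0)) * ∑ k, pd k (fun y => β y k) x := by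
  have := (ha x).ne'
  unfold Khat
  field_simp
  ring

/-- contraction of a symmetric tracefree matrix only sees the symmetric tracefree part -/
lemma contract_symm (K M : Fin 3 → Fin 3 → ℝ) (hs : ∀ i l, K i l = K l i)
    (ht : ∑ i, K i i = 0) :
    ∑ i, ∑ l, K i l * M i l = ∑ i, ∑ l, K i l * ((1 / 2) * (M l i + M i l)
      + (-(1 / 3) * (if i = l then (1 : ℝ) else 0)) * ∑ k, M k k) := by
  simp only [Fin.sum_univ_three] at ht ⊢
  simp [hs 1 0, hs 2 0, hs 2 1]
  linear_combination (1 / 3) * (M 0 0 + M 1 1 + M 2 2) * ht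

lemma contract1 {a : E3 → ℝ} {β : E3 → Fin 3 → ℝ} (ha : ∀ x, 0 < a x) (x : E3) :
    ∑ i, ∑ l, Khat a β i l x * pd l (fun y => β y i) x = a x * KK a β x := by
  rw [contract_symm (fun i l => Khat a β i l x) (fun i l => pd l (fun y => β y i) x)
    (fun i l => Khat_symm a β i l x) (Khat_trace a β x)]
  simp only [← alpha_Khat ha]
  simp only [KK, Finset.mul_sum]
  refine Finset.sum_congr rfl fun i _ => Finset.sum_congr rfl fun l _ => ?_
  rw [Khat_symm a β l i]
  ring

lemma pd_KK {a : E3 → ℝ} {β : E3 → Fin 3 → ℝ} (ha : ∀ x, 0 < a x)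
    (haC : ContDiff ℝ (⊤ : ℕ∞) a) (hβC : ∀ i, ContDiff ℝ (⊤ : ℕ∞) fun x => β x i)
    (k : Fin 3) (x : E3) :
    pd k (KK a β) x = 2 * ∑ i, ∑ l, Khat a β i l x * pd k (Khat a β i l) x := by
  have hK := contDiff_Khat ha haC hβC
  have : KK a β = fun y => ∑ i, ∑ l, Khat a β i l y * Khat a β i l y := by
    funext y
    unfold KK
    refine Finset.sum_congr rfl fun i _ => Finset.sum_congr rfl fun l _ => ?_
    rw [Khat_symm a β l i]
  rw [this, pd_sum (f := fun i y => ∑ l, Khat a β i l y * Khat a β i l y)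
    (fun i => ContDiff.sum fun l _ => (hK i l).mul (hK i l)), Finset.mul_sum]
  refine Finset.sum_congr rfl fun i _ => ?_
  rw [pd_sum (f := fun l y => Khat a β i l y * Khat a β i l y)
    (fun l => (hK i l).mul (hK i l)), Finset.mul_sum]
  refine Finset.sum_congr rfl fun l _ => ?_
  rw [pd_mul (hK i l) (hK i l)]
  ring

lemma contDiff_KK {a : E3 → ℝ} {β : E3 → Fin 3 → ℝ} (ha : ∀ x, 0 < a x)
    (haC : ContDiff ℝ (⊤ : ℕ∞) a) (hβC : ∀ i, ContDiff ℝ (⊤ : ℕ∞) fun x => β x i) :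
    ContDiff ℝ (⊤ : ℕ∞) (KK a β) := by
  have hK := contDiff_Khat ha haC hβC
  exact ContDiff.sum fun i _ => ContDiff.sum fun l _ => (hK i l).mul (hK l i)

lemma pd_add {f g : E3 → ℝ} (hf : ContDiff ℝ (⊤ : ℕ∞) f) (hg : ContDiff ℝ (⊤ : ℕ∞) g)
    (i : Fin 3) (x : E3) :
    pd i (fun y => f y + g y) x = pd i f x + pd i g x := by
  unfold pd
  rw [fderiv_fun_add (hf.differentiable (by simp) x) (hg.differentiable (by simp) x)]
  simp

lemma pd_const_mul {f : E3 → ℝ} (hf : ContDiff ℝ (⊤ : ℕ∞) f) (c : ℝ)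
    (i : Fin 3) (x : E3) :
    pd i (fun y => c * f y) x = c * pd i f x := by
  unfold pd
  rw [fderiv_const_mul (hf.differentiable (by simp) x)]
  simp

lemma contract2 {a : E3 → ℝ} {β : E3 → Fin 3 → ℝ} (ha : ∀ x, 0 < a x)
    (haC : ContDiff ℝ (⊤ : ℕ∞) a) (hβC : ∀ i, ContDiff ℝ (⊤ : ℕ∞) fun x => β x i)
    (k : Fin 3) (x : E3) :
    ∑ i, ∑ l, Khat a β i l x * pd k (pd l (fun y => β y i)) x
      = pd k a x * KK a β x + a x / 2 * pd k (KK a β) x := by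
  have hK := contDiff_Khat ha haC hβC
  have hB : ∀ i l, ContDiff ℝ (⊤ : ℕ∞) (pd l (fun y => β y i)) :=
    fun i l => contDiff_pd (hβC i) l
  have key : ∀ i l, pd k a x * Khat a β i l x + a x * pd k (Khat a β i l) x
      = (1 / 2) * (pd k (pd i (fun y => β y l)) x + pd k (pd l (fun y => β y i)) x)
      + (-(1 / 3) * (if i = l then (1 : ℝ) else 0)) * ∑ m, pd k (pd m (fun y => β y m)) x := by
    intro i l
    rw [← pd_mul haC (hK i l)]
    have : (fun y => a y * Khat a β i l y) = _ := funext fun y => alpha_Khat ha i l y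
    rw [this, pd_add (contDiff_const.mul ((hB l i).add (hB i l)))
      (contDiff_const.mul (ContDiff.sum fun m _ => hB m m)),
      pd_const_mul ((hB l i).add (hB i l)), pd_const_mul (ContDiff.sum fun m _ => hB m m),
      pd_add (hB l i) (hB i l), pd_sum (fun m => hB m m)]
  rw [contract_symm (fun i l => Khat a β i l x) (fun i l => pd k (pd l (fun y => β y i)) x)
    (fun i l => Khat_symm a β i l x) (Khat_trace a β x)]
  simp only [← key]
  rw [pd_KK ha haC hβC]
  simp only [KK, Finset.mul_sum, ← Finset.sum_add_distrib]
  refine Finset.sum_congr rfl fun i _ => Finset.sum_congr rfl fun l _ => ?_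
  rw [Khat_symm a β l i]
  ring

lemma four_int {A B C D : E3 → ℝ} (hA : Integrable A) (hB : Integrable B) (hC : Integrable C)
    (hD : Integrable D) (c : ℝ) :
    ∫ x, (c * A x - (1 / 2) * B x + (1 / 2) * C x + (1 / 2) * D x)
      = c * (∫ x, A x) - (1 / 2) * (∫ x, B x) + (1 / 2) * (∫ x, C x) + (1 / 2) * ∫ x, D x := by
  have h1 : Integrable fun x => c * A x := hA.const_mul _
  have h2 : Integrable fun x => (1 / 2) * B x := hB.const_mul _
  have h3 : Integrable fun x => (1 / 2) * C x := hC.const_mul _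
  have h4 : Integrable fun x => (1 / 2) * D x := hD.const_mul _
  have h12 : Integrable fun x => c * A x - (1 / 2) * B x := h1.sub h2
  have h123 : Integrable fun x => c * A x - (1 / 2) * B x + (1 / 2) * C x := h12.add h3
  rw [integral_add h123 h4, integral_add h12 h3, integral_sub h1 h2]
  simp only [integral_const_mul]

/-- Step (4) of the virial derivation (Eq. 66):
`−∫ ψ⁶ j_i x^k ∂_k β^i dV
  = (1/16π) ∫ [8π ψ⁶ j_k β^k + ψ¹² K̂_i^j K̂_j^i x^k ∂_k(α ψ⁻⁶)] dV`. -/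
theorem virial_step4
    (α ψ : E3 → ℝ) (β j : E3 → Fin 3 → ℝ)
    (hα : ∀ x, 0 < α x) (hψ : ∀ x, 0 < ψ x)
    (hαC : ContDiff ℝ (⊤ : ℕ∞) α) (hψC : ContDiff ℝ (⊤ : ℕ∞) ψ)
    (hβC : ∀ i, ContDiff ℝ (⊤ : ℕ∞) fun x => β x i)
    (hjC : ∀ i, ContDiff ℝ (⊤ : ℕ∞) fun x => j x i)
    (hjsupp : ∀ i, HasCompactSupport fun x => j x i)
    -- momentum constraint ∂_j(ψ⁶ K̂_i^j) = 8π j_i ψ⁶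
    (hmom : ∀ x : E3, ∀ i : Fin 3,
      (∑ l, pd l (fun y => ψ y ^ 6 * Khat α β i l y) x) = 8 * π * j x i * ψ x ^ 6)
    -- integrability of the displayed integrands
    (hint1 : Integrable fun x : E3 =>
      ψ x ^ 6 * ∑ i, j x i * ∑ k, x k * pd k (fun y => β y i) x)
    (hint2 : Integrable fun x : E3 => ψ x ^ 6 * ∑ k, j x k * β x k)
    (hint3 : Integrable fun x : E3 => α x * ψ x ^ 6 * KK α β x)
    (hint4 : Integrable fun x : E3 =>
      ψ x ^ 12 * KK α β x * ∑ k, x k * pd k (fun y => α y / ψ y ^ 6) x)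
    (hdiv1 : Integrable fun x : E3 =>
      ∑ l, pd l (fun y => ψ y ^ 6 * ∑ i, Khat α β i l y * β y i) x)
    (hdiv2 : Integrable fun x : E3 =>
      ∑ l, pd l (fun y =>
        ψ y ^ 6 * ∑ i, Khat α β i l y * ∑ k, y k * pd k (fun z => β z i) y) x)
    (hdiv3 : Integrable fun x : E3 =>
      ∑ k, pd k (fun y => α y * ψ y ^ 6 * KK α β y * y k) x)
    -- vanishing fluxes at infinity
    (hflux1 : Tendsto (flux fun x l =>
      ψ x ^ 6 * ∑ i, Khat α β i l x * β x i) atTop (𝓝 0))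
    (hflux2 : Tendsto (flux fun x l =>
      ψ x ^ 6 * ∑ i, Khat α β i l x * ∑ k, x k * pd k (fun y => β y i) x)
      atTop (𝓝 0))
    (hflux3 : Tendsto (flux fun x k =>
      ψ x ^ 6 * ∑ i, Khat α β i k x * ∑ l, x l * pd l (fun y => β y i) x)
      atTop (𝓝 0))
    (hflux4 : Tendsto (flux fun x k =>
      α x * ψ x ^ 6 * KK α β x * x k) atTop (𝓝 0)) :
    -(∫ x : E3, ψ x ^ 6 * ∑ i, j x i * ∑ k, x k * pd k (fun y => β y i) x)
      = (1 / (16 * π)) * ∫ x : E3,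
          8 * π * ψ x ^ 6 * (∑ k, j x k * β x k)
            + ψ x ^ 12 * KK α β x * ∑ k, x k * pd k (fun y => α y / ψ y ^ 6) x := by
  have hK := contDiff_Khat hα hαC hβC
  have hKK := contDiff_KK hα hαC hβC
  have hψ6 : ContDiff ℝ (⊤ : ℕ∞) fun y => ψ y ^ 6 := hψC.pow 6
  have hS : ∀ i l, ContDiff ℝ (⊤ : ℕ∞) fun y => ψ y ^ 6 * Khat α β i l y :=
    fun i l => hψ6.mul (hK i l)
  have hv : ∀ i, ContDiff ℝ (⊤ : ℕ∞) fun y : E3 => ∑ k, y k * pd k (fun z => β z i) y :=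
    fun i => contDiff_euler (hβC i)
  -- pointwise divergence identities
  have d1 : ∀ x : E3, ∑ l, pd l (fun y => ψ y ^ 6 * ∑ i, Khat α β i l y * β y i) x
      = 8 * π * (ψ x ^ 6 * ∑ k, j x k * β x k) + α x * ψ x ^ 6 * KK α β x := by
    intro x
    have h := div_contract (fun i l y => ψ y ^ 6 * Khat α β i l y) (fun i y => β y i) hS hβC x
    have e : ∀ l, (fun y => ψ y ^ 6 * ∑ i, Khat α β i l y * β y i)
        = fun y => ∑ i, ψ y ^ 6 * Khat α β i l y * β y i := by
      intro l; funext y; simp only [Finset.mul_sum, mul_assoc]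
    simp only [e]
    rw [h]
    simp only [hmom]
    have c := contract1 (β := β) hα x
    simp only [Fin.sum_univ_three] at c ⊢
    linear_combination ψ x ^ 6 * c
  have d3 : ∀ x : E3, ∑ k, pd k (fun y => α y * ψ y ^ 6 * KK α β y * y k) x
      = ∑ k, ((pd k α x * ψ x ^ 6 + α x * pd k (fun y => ψ y ^ 6) x) * KK α β x
          + α x * ψ x ^ 6 * pd k (KK α β) x) * x k + 3 * (α x * ψ x ^ 6 * KK α β x) := by
    intro x
    simp only [pd_mul ((hαC.mul hψ6).mul hKK) (contDiff_coord _), pd_mul (hαC.mul hψ6) hKK,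
      pd_mul hαC hψ6, pd_coord, if_true, Fin.sum_univ_three]
    ring
  have hq : ∀ (k : Fin 3) (x : E3), ψ x ^ 12 * pd k (fun y => α y / ψ y ^ 6) x
      = ψ x ^ 6 * pd k α x - α x * pd k (fun y => ψ y ^ 6) x := by
    intro k x
    have hqC : ContDiff ℝ (⊤ : ℕ∞) fun y => α y / ψ y ^ 6 :=
      hαC.div hψ6 (fun y => (pow_pos (hψ y) 6).ne')
    have e : α = fun y => (α y / ψ y ^ 6) * ψ y ^ 6 := by
      funext y
      have := (hψ y).ne'
      field_simp
    have h := pd_mul hqC hψ6 k x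
    rw [← e] at h
    rw [h]
    have := (hψ x).ne'
    field_simp
    ring
  have d2 : ∀ x : E3, ∑ l, pd l (fun y =>
        ψ y ^ 6 * ∑ i, Khat α β i l y * ∑ k, y k * pd k (fun z => β z i) y) x
      = 8 * π * (ψ x ^ 6 * ∑ i, j x i * ∑ k, x k * pd k (fun y => β y i) x)
        - (1 / 2) * (α x * ψ x ^ 6 * KK α β x)
        + (1 / 2) * (∑ k, pd k (fun y => α y * ψ y ^ 6 * KK α β y * y k) x)
        + (1 / 2) *
          (ψ x ^ 12 * KK α β x * ∑ k, x k * pd k (fun y => α y / ψ y ^ 6) x) := by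
    intro x
    have h := div_contract (fun i l y => ψ y ^ 6 * Khat α β i l y)
      (fun i y => ∑ k, y k * pd k (fun z => β z i) y) hS hv x
    have e : ∀ l, (fun y : E3 => ψ y ^ 6 * ∑ i, Khat α β i l y *
          ∑ k, y k * pd k (fun z => β z i) y)
        = fun y => ∑ i, ψ y ^ 6 * Khat α β i l y * ∑ k, y k * pd k (fun z => β z i) y := by
      intro l; funext y
      rw [Finset.mul_sum]
      simp only [mul_assoc]
    simp only [e]
    rw [h]
    simp only [hmom, pd_euler (hβC _)]
    rw [d3]
    have c1 := contract1 (β := β) hα x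
    have c2 := fun k => contract2 hα hαC hβC k x
    have T : ∑ i, ∑ l, ψ x ^ 6 * Khat α β i l x *
        (pd l (fun y => β y i) x + ∑ k, x k * pd k (pd l (fun y => β y i)) x)
        = ψ x ^ 6 * (α x * KK α β x) + ψ x ^ 6 * ∑ k, x k *
          (pd k α x * KK α β x + α x / 2 * pd k (KK α β) x) := by
      rw [← c1]
      simp only [← c2]
      simp only [Fin.sum_univ_three]
      ring
    rw [T]
    have Q : ψ x ^ 12 * KK α β x * ∑ k, x k * pd k (fun y => α y / ψ y ^ 6) x
        = KK α β x * ∑ k, x k * (ψ x ^ 6 * pd k α x - α x * pd k (fun y => ψ y ^ 6) x) := by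
      simp only [← hq, Finset.mul_sum]
      refine Finset.sum_congr rfl fun k _ => ?_
      ring
    rw [Q]
    simp only [Fin.sum_univ_three]
    ring
  -- divergence theorem
  have z1 := div_int_zero (fun x l => ψ x ^ 6 * ∑ i, Khat α β i l x * β x i)
    (fun l => hψ6.mul (ContDiff.sum fun i _ => (hK i l).mul (hβC i))) hdiv1 hflux1
  have z2 := div_int_zero
    (fun x l => ψ x ^ 6 * ∑ i, Khat α β i l x * ∑ k, x k * pd k (fun y => β y i) x)
    (fun l => hψ6.mul (ContDiff.sum fun i _ => (hK i l).mul (hv i))) hdiv2 hflux2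
  have z3 := div_int_zero (fun x k => α x * ψ x ^ 6 * KK α β x * x k)
    (fun k => ((hαC.mul hψ6).mul hKK).mul (contDiff_coord k)) hdiv3 hflux4
  simp only [d1] at z1
  rw [integral_add (hint2.const_mul _) hint3, integral_const_mul] at z1
  simp only [d2] at z2
  rw [four_int hint1 hint3 hdiv3 hint4, z3] at z2
  simp only [mul_assoc (8 * π)]
  rw [integral_add (hint2.const_mul _) hint4, integral_const_mul]
  have hπ := Real.pi_pos.ne'
  field_simp
  linear_combination (-2) * z2 - z1
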